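/- arXiv:2210.07989 — 4 statements merged into one kernel-verified Lean document; each statement's English description precedes it below -/
import Mathlib

section
/- Let φ and ψ be lsc submeasures such that I = Exh(φ) and J = Exh(ψ) are translation invariant ideals, with I tall. Let a be a uniform base sequence adapted to both I and J. Suppose there exists d > 0 such that inf{ φ(P) : P a finite interval in ℕ with ψ(P) ≥ d } = 0. Let H_I = { r ∈ ℝ : j_a(|r|) ∈ I } and H_J = { r ∈ ℝ : j_a(|r|) ∈ J }, with ρ_I(r,s) = φ(j_a(|r−s|)) + |r−s| on H_I and ρ_J(r,s) = ψ(j_a(|r−s|)) + |r−s| on H_J. Then every map f : H_I → H_J that is additive, satisfies f(q·r) = q·f(r) for all q ∈ ℚ_a and r ∈ H_I, and is ρ-continuous (meaning: for every r ∈ H_I and ε > 0 there is δ > 0 such that for all s ∈ H_I, ρ_I(r,s) < δ implies ρ_J(f(r), f(s)) < ε) is constantly equal to zero. -/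
open Set Filter
open scoped ENNReal

/-- `a₀ a₁ ⋯ a_{n-1}` as a real number: the product of the first `n` terms of the
base sequence (the paper's `a₁ ⋯ a_n`, re-indexed from 0). -/
noncomputable def bProd (a : ℕ → ℕ) (n : ℕ) : ℝ := ∏ k ∈ Finset.range n, (a k : ℝ)

/-- The `n`-th digit (0-indexed; the paper's `(n+1)`-st digit) of the nonnegative
real `r` in base `a`:  `r_n = ⌊a₁⋯a_n (r - ⌊r⌋)⌋ - a_n ⌊a₁⋯a_{n-1} (r - ⌊r⌋)⌋`. -/
noncomputable def digit (a : ℕ → ℕ) (r : ℝ) (n : ℕ) : ℤ :=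
  ⌊bProd a (n + 1) * Int.fract r⌋ - (a n : ℤ) * ⌊bProd a n * Int.fract r⌋

/-- `j_a(r) = { n : r_n ≠ r_{n+1} }`. -/
def jSet (a : ℕ → ℕ) (r : ℝ) : Set ℕ := {n | digit a r n ≠ digit a r (n + 1)}

/-- An ideal of subsets of ℕ: closed under subsets and finite unions, containing
all singletons (hence nonempty). -/
def IsIdeal (I : Set (Set ℕ)) : Prop :=
  (∀ ⦃x y : Set ℕ⦄, x ∈ I → y ⊆ x → y ∈ I) ∧
  (∀ ⦃x y : Set ℕ⦄, x ∈ I → y ∈ I → x ∪ y ∈ I) ∧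
  (∀ n : ℕ, ({n} : Set ℕ) ∈ I)

/-- Translation invariance of a family of subsets of ℕ. -/
def TransInv (I : Set (Set ℕ)) : Prop :=
  ∀ x ∈ I, ({n | ∃ m ∈ x, n = m + 1} ∈ I) ∧ ({n | n + 1 ∈ x} ∈ I)

/-- A tall family: every infinite set of naturals has an infinite subset in the family. -/
def TallIdeal (I : Set (Set ℕ)) : Prop :=
  ∀ x : Set ℕ, x.Infinite → ∃ y, y ⊆ x ∧ y.Infinite ∧ y ∈ I

/-- The base sequence `a` is adapted to `I` if `{n : a_n ≠ a_{n+1}} ∈ I`. -/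
def AdaptedTo (a : ℕ → ℕ) (I : Set (Set ℕ)) : Prop := {n | a n ≠ a (n + 1)} ∈ I

/-- A lower semicontinuous submeasure on subsets of ℕ. -/
def IsLscSubmeasure (φ : Set ℕ → ℝ≥0∞) : Prop :=
  φ ∅ = 0 ∧
  (∀ ⦃x y : Set ℕ⦄, x ⊆ y → φ x ≤ φ y) ∧
  (∀ x y : Set ℕ, φ (x ∪ y) ≤ φ x + φ y) ∧
  (∀ n : ℕ, 0 < φ {n} ∧ φ {n} < ⊤) ∧
  (∀ x : Set ℕ, φ x = ⨆ n : ℕ, φ (x ∩ {k | k < n}))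

/-- `Exh(φ) = { x ⊆ ℕ : φ(x \ {0,…,n-1}) → 0 }`. -/
def Exh (φ : Set ℕ → ℝ≥0∞) : Set (Set ℕ) :=
  {x | Filter.Tendsto (fun n => φ (x \ {k | k < n})) Filter.atTop (nhds 0)}

/-- `pr(a)`: the set of primes dividing `a_n` for all but finitely many `n`. -/
def prSet (a : ℕ → ℕ) : Set ℕ := {p | p.Prime ∧ ∀ᶠ n in Filter.atTop, p ∣ a n}

/-- A base sequence is uniform if every prime dividing some `a_n` divides `a_n`
for all but finitely many `n`. -/
def UniformBase (a : ℕ → ℕ) : Prop :=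
  ∀ p : ℕ, p.Prime → (∃ n, p ∣ a n) → ∀ᶠ n in Filter.atTop, p ∣ a n

/-- `ℚ_a`, viewed as a set of real numbers: fractions `k/l` with every prime
divisor of `l` in `pr(a)`. -/
def Qa (a : ℕ → ℕ) : Set ℝ :=
  {r | ∃ (k : ℤ) (l : ℕ), 0 < l ∧ (∀ p : ℕ, p.Prime → p ∣ l → p ∈ prSet a) ∧
    r = (k : ℝ) / (l : ℝ)}

/-- `H = { r ∈ ℝ : j_a(|r|) ∈ I }`. -/
def Hset (a : ℕ → ℕ) (I : Set (Set ℕ)) : Set ℝ := {r | jSet a |r| ∈ I}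

/-- `ρ(r,s) = φ(j_a(|r-s|)) + |r-s|`. -/
noncomputable def rho (a : ℕ → ℕ) (φ : Set ℕ → ℝ≥0∞) (r s : ℝ) : ℝ :=
  (φ (jSet a |r - s|)).toReal + |r - s|

lemma bProd_eq_cast (a : ℕ → ℕ) (n : ℕ) :
    bProd a n = ((∏ k ∈ Finset.range n, a k : ℕ) : ℝ) := by
  simp [bProd]

lemma bProd_succ (a : ℕ → ℕ) (n : ℕ) : bProd a (n + 1) = a n * bProd a n := by
  rw [bProd, bProd, Finset.prod_range_succ, mul_comm]

lemma two_pow_mul_bProd_le {a : ℕ → ℕ} (ha : ∀ n, 2 ≤ a n) (n K : ℕ) :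
    2 ^ K * bProd a n ≤ bProd a (n + K) := by
  have hpos : 0 ≤ bProd a n := Finset.prod_nonneg fun _ _ => Nat.cast_nonneg _
  induction K with
  | zero => simp
  | succ K ih =>
    rw [← add_assoc, bProd_succ, pow_succ']
    have h2 : (2 : ℝ) ≤ a (n + K) := by exact_mod_cast ha (n + K)
    have : 0 ≤ 2 ^ K * bProd a n := by positivity
    nlinarith

lemma one_le_bProd {a : ℕ → ℕ} (ha : ∀ n, 2 ≤ a n) (n : ℕ) : 1 ≤ bProd a n := by
  have h := two_pow_mul_bProd_le ha 0 n
  have h1 : (1 : ℝ) ≤ 2 ^ n := one_le_pow₀ (by norm_num)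
  simp only [zero_add] at h
  have h0 : bProd a 0 = 1 := by simp [bProd]
  rw [h0] at h
  linarith

lemma bProd_mono {a : ℕ → ℕ} (ha : ∀ n, 2 ≤ a n) : Monotone (bProd a) := by
  refine monotone_nat_of_le_succ fun n => ?_
  have h := two_pow_mul_bProd_le ha n 1
  have := one_le_bProd ha n
  linarith

lemma tendsto_inv_bProd {a : ℕ → ℕ} (ha : ∀ n, 2 ≤ a n) :
    Tendsto (fun n => (bProd a n)⁻¹) atTop (nhds 0) := by
  refine tendsto_inv_atTop_zero.comp ?_
  refine tendsto_atTop_mono (fun n => ?_) (tendsto_pow_atTop_atTop_of_one_lt (one_lt_two (α := ℝ)))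
  have h := two_pow_mul_bProd_le ha 0 n
  simpa [bProd] using h

lemma int_div_bProd_mem_Qa {a : ℕ → ℕ} (ha : ∀ n, 2 ≤ a n) (hu : UniformBase a)
    (z : ℤ) (n : ℕ) : (z : ℝ) / bProd a n ∈ Qa a := by
  refine ⟨z, ∏ k ∈ Finset.range n, a k, ?_, fun p hp hdvd => ⟨hp, hu p hp ?_⟩, ?_⟩
  · exact Finset.prod_pos fun k _ => by have := ha k; omega
  · obtain ⟨k, -, hk⟩ := (hp.prime.dvd_finsetProd_iff _).1 hdvd
    exact ⟨k, hk⟩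
  · rw [bProd_eq_cast]

lemma int_mem_Qa (a : ℕ → ℕ) (z : ℤ) : (z : ℝ) ∈ Qa a := by
  refine ⟨z, 1, one_pos, fun p hp hdvd => ?_, by simp⟩
  exact absurd (Nat.dvd_one.1 hdvd) hp.ne_one

lemma digit_zero (a : ℕ → ℕ) (k : ℕ) : digit a 0 k = 0 := by
  simp [digit]

/-- Reals differing by an integer multiple of `1 / (a₀ ⋯ a_{n-1})` have the same digits
from place `n` on. -/
lemma digit_eq_of_sub_mul_bProd_eq_int {a : ℕ → ℕ} {r s : ℝ} {n : ℕ} {z : ℤ}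
    (h : (r - s) * bProd a n = z) {k : ℕ} (hk : n ≤ k) : digit a r k = digit a s k := by
  have key : ∀ k, n ≤ k → ∃ u : ℤ, bProd a k * Int.fract r = bProd a k * Int.fract s + u := by
    intro k hk
    induction k, hk using Nat.le_induction with
    | base =>
      refine ⟨z - (∏ k ∈ Finset.range n, a k : ℕ) * (⌊r⌋ - ⌊s⌋), ?_⟩
      have := bProd_eq_cast a n
      simp only [Int.fract]
      push_cast [← h] at this ⊢
      rw [← this]
      ring
    | succ k _ ih =>
      obtain ⟨u, hu⟩ := ih
      refine ⟨a k * u, ?_⟩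
      rw [bProd_succ, mul_assoc, hu]
      push_cast
      ring
  obtain ⟨u, hu⟩ := key k hk
  have hu' : bProd a (k + 1) * Int.fract r = bProd a (k + 1) * Int.fract s + (a k * u : ℤ) := by
    rw [bProd_succ, mul_assoc, hu]
    push_cast
    ring
  rw [digit, digit, hu, hu', Int.floor_add_intCast, Int.floor_add_intCast]
  ring

lemma digit_eq_zero_of_mul_bProd_eq_int {a : ℕ → ℕ} {r : ℝ} {n : ℕ} {z : ℤ}
    (h : r * bProd a n = z) {k : ℕ} (hk : n ≤ k) : digit a r k = 0 := by
  rw [← digit_zero a k]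
  exact digit_eq_of_sub_mul_bProd_eq_int (by rwa [sub_zero]) hk

lemma digit_eq_zero_of_lt {a : ℕ → ℕ} (ha : ∀ n, 2 ≤ a n) {r : ℝ} (h0 : 0 ≤ r) {n : ℕ}
    (h : r * bProd a n < 1) {k : ℕ} (hk : k < n) : digit a r k = 0 := by
  have hlt : ∀ i ≤ n, bProd a i * r < 1 := fun i hi => by
    have := mul_le_mul_of_nonneg_right (bProd_mono ha hi) h0
    linarith
  have hfl : ∀ i ≤ n, ⌊bProd a i * r⌋ = 0 := fun i hi => by
    rw [Int.floor_eq_zero_iff]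
    exact ⟨mul_nonneg (zero_le_one.trans (one_le_bProd ha i)) h0, hlt i hi⟩
  have hr1 : Int.fract r = r :=
    Int.fract_eq_self.2 ⟨h0, by simpa [bProd] using hlt 0 (Nat.zero_le _)⟩
  rw [digit, hr1, hfl _ hk, hfl _ hk.le]
  simp

/-- The integer whose base-`a` expansion has digits `e 0, …, e (n - 1)`. -/
def digitNum (a : ℕ → ℕ) (e : ℕ → ℤ) : ℕ → ℤ
  | 0 => 0
  | n + 1 => a n * digitNum a e n + e n

lemma floor_bProd_mul_eq_digitNum {a : ℕ → ℕ} (ha : ∀ n, 2 ≤ a n) {e : ℕ → ℤ}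
    (he : ∀ n, e n = 0 ∨ e n = 1) {y : ℝ} {N : ℕ} (hN : ⌊bProd a N * y⌋ = digitNum a e N)
    {k : ℕ} (hk : k ≤ N) : ⌊bProd a k * y⌋ = digitNum a e k := by
  induction hk using Nat.decreasingInduction with
  | self => exact hN
  | of_succ k _ ih =>
    rw [Int.floor_eq_iff, bProd_succ, digitNum] at ih
    rw [Int.floor_eq_iff]
    have h2 : (2 : ℝ) ≤ a k := by exact_mod_cast ha k
    push_cast at ih
    have he' : (0 : ℝ) ≤ e k ∧ (e k : ℝ) ≤ 1 := by
      rcases he k with h | h <;> simp [h]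
    constructor <;> by_contra! hcon <;> nlinarith

lemma digit_eq_of_floor_eq_digitNum {a : ℕ → ℕ} (ha : ∀ n, 2 ≤ a n) {e : ℕ → ℤ}
    (he : ∀ n, e n = 0 ∨ e n = 1) {y : ℝ} {N : ℕ} (hN : ⌊bProd a N * y⌋ = digitNum a e N)
    {k : ℕ} (hk : k < N) : digit a y k = e k := by
  have h0 : ⌊y⌋ = 0 := by
    simpa [bProd, digitNum] using floor_bProd_mul_eq_digitNum ha he hN (Nat.zero_le _)
  have hy : Int.fract y = y := by simp [Int.fract, h0]
  rw [digit, hy, floor_bProd_mul_eq_digitNum ha he hN hk,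
    floor_bProd_mul_eq_digitNum ha he hN hk.le, digitNum]
  ring

namespace IsLscSubmeasure

variable {φ : Set ℕ → ℝ≥0∞}

lemma mem_Exh_of_subset_Icc (hφ : IsLscSubmeasure φ) {x : Set ℕ} {m n : ℕ}
    (hx : x ⊆ Icc m n) : x ∈ Exh φ := by
  refine tendsto_const_nhds.congr' ?_
  filter_upwards [eventually_gt_atTop n] with i hi
  have : x \ {k | k < i} = ∅ := by
    ext k
    simp only [Set.mem_sdiff, mem_ofPred_eq, mem_empty_iff_false, iff_false, not_and, not_not]
    exact fun hk => (hx hk).2.trans_lt hi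
  rw [this, hφ.1]

lemma lt_top_of_subset_Iio (hφ : IsLscSubmeasure φ) (n : ℕ) {x : Set ℕ}
    (hx : x ⊆ {k | k < n}) : φ x < ⊤ := by
  refine (hφ.2.1 hx).trans_lt ?_
  clear hx
  induction n with
  | zero => simp [hφ.1]
  | succ n ih =>
    have : {k | k < n + 1} = {k | k < n} ∪ {n} := by ext; simp; omega
    rw [this]
    exact (hφ.2.2.1 _ _).trans_lt (ENNReal.add_lt_top.2 ⟨ih, (hφ.2.2.2.1 n).2⟩)

lemma lt_top_of_mem_Exh (hφ : IsLscSubmeasure φ) {x : Set ℕ} (hx : x ∈ Exh φ) : φ x < ⊤ := by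
  obtain ⟨n, hn⟩ := (Tendsto.eventually_lt_const ENNReal.zero_lt_top hx).exists
  have : x = (x ∩ {k | k < n}) ∪ (x \ {k | k < n}) := (inter_union_sdiff _ _).symm
  rw [this]
  exact (hφ.2.2.1 _ _).trans_lt
    (ENNReal.add_lt_top.2 ⟨hφ.lt_top_of_subset_Iio n inter_subset_right, hn⟩)

lemma tendsto_singleton (hφ : IsLscSubmeasure φ) (htall : TallIdeal (Exh φ)) :
    Tendsto (fun n => φ {n}) atTop (nhds 0) := by
  rw [ENNReal.tendsto_nhds_zero]
  intro ε hε
  by_contra hcon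
  have hinf : {n | ε < φ {n}}.Infinite := by
    rw [← Nat.frequently_atTop_iff_infinite]
    simpa [Filter.Frequently] using hcon
  obtain ⟨y, hy, hyinf, hyI⟩ := htall _ hinf
  obtain ⟨n, hn⟩ := (Tendsto.eventually_lt_const hε hyI).exists
  obtain ⟨k, hky, hnk⟩ := hyinf.exists_gt n
  have h1 : φ {k} ≤ φ (y \ {k | k < n}) := by
    refine hφ.2.1 (singleton_subset_iff.2 ⟨hky, ?_⟩)
    simpa using hnk.le
  exact lt_asymm (hy hky) (h1.trans_lt hn)

lemma tendsto_Icc (hφ : IsLscSubmeasure φ) (htall : TallIdeal (Exh φ)) (L : ℕ) :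
    Tendsto (fun n => φ (Icc n (n + L))) atTop (nhds 0) := by
  induction L with
  | zero => simpa using hφ.tendsto_singleton htall
  | succ L ih =>
    have h := ih.add ((tendsto_add_atTop_iff_nat (L + 1)).2 (hφ.tendsto_singleton htall))
    rw [add_zero] at h
    refine tendsto_of_tendsto_of_tendsto_of_le_of_le tendsto_const_nhds h
      (fun _ => zero_le) fun n => ?_
    refine (hφ.2.1 ?_).trans (hφ.2.2.1 (Icc n (n + L)) {n + (L + 1)})
    intro k hk
    simp only [mem_Icc, mem_union, mem_singleton_iff] at hk ⊢
    omega

lemma exists_pos_le_singleton (hφ : IsLscSubmeasure φ) (M : ℕ) :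
    ∃ ε : ℝ≥0∞, 0 < ε ∧ ∀ k < M, ε ≤ φ {k} := by
  induction M with
  | zero => exact ⟨1, one_pos, by simp⟩
  | succ M ih =>
    obtain ⟨ε, hε, h⟩ := ih
    refine ⟨min ε (φ {M}), lt_min hε (hφ.2.2.2.1 M).1, fun k hk => ?_⟩
    rcases Nat.lt_succ_iff_lt_or_eq.1 hk with hk | rfl
    · exact (min_le_left _ _).trans (h k hk)
    · exact min_le_right _ _

end IsLscSubmeasure

lemma rho_lt_of_lt {a : ℕ → ℕ} {φ : Set ℕ → ℝ≥0∞} {r s δ : ℝ}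
    (h1 : φ (jSet a |r - s|) < ENNReal.ofReal (δ / 2)) (h2 : |r - s| < δ / 2) :
    rho a φ r s < δ := by
  have := ENNReal.toReal_lt_of_lt_ofReal h1
  rw [rho]
  linarith

lemma mem_Hset_of_mul_bProd_eq_int {a : ℕ → ℕ} {φ : Set ℕ → ℝ≥0∞} (hφ : IsLscSubmeasure φ)
    {r : ℝ} (h0 : 0 ≤ r) {n : ℕ} {z : ℤ} (h : r * bProd a n = z) : r ∈ Hset a (Exh φ) := by
  refine hφ.mem_Exh_of_subset_Icc (m := 0) (n := n) fun k hk => ?_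
  rw [jSet, mem_ofPred_eq, abs_of_nonneg h0] at hk
  refine ⟨Nat.zero_le _, le_of_not_gt fun hnk => hk ?_⟩
  rw [digit_eq_zero_of_mul_bProd_eq_int h hnk.le,
    digit_eq_zero_of_mul_bProd_eq_int h (hnk.le.trans k.le_succ)]

/-- Truncations of base-`a` expansions are dense in `H_I`. -/
lemma exists_truncation {a : ℕ → ℕ} (ha : ∀ n, 2 ≤ a n) {φ : Set ℕ → ℝ≥0∞}
    (hφ : IsLscSubmeasure φ) (htall : TallIdeal (Exh φ)) {r : ℝ} (h0 : 0 ≤ r)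
    (hr : r ∈ Hset a (Exh φ)) {δ : ℝ} (hδ : 0 < δ) :
    ∃ (n : ℕ) (z : ℤ), 0 ≤ (z : ℝ) / bProd a n ∧ rho a φ r (z / bProd a n) < δ ∧
      |r - z / bProd a n| < δ := by
  rw [Hset, mem_ofPred_eq, abs_of_nonneg h0] at hr
  have hlim := ((hφ.tendsto_singleton htall).add ((tendsto_add_atTop_iff_nat 1).2 hr))
  rw [add_zero] at hlim
  have hev1 := hlim.eventually_lt_const (ENNReal.ofReal_pos.2 (half_pos hδ))
  have hev2 := ((tendsto_add_atTop_iff_nat 1).2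
    (tendsto_inv_bProd ha)).eventually_lt_const (half_pos hδ)
  obtain ⟨n, hn1, hn2⟩ := (hev1.and hev2).exists
  set B := bProd a (n + 1) with hB
  have hBpos : 0 < B := zero_lt_one.trans_le (one_le_bProd ha _)
  set z := ⌊r * B⌋
  have hzle : (z : ℝ) ≤ r * B := Int.floor_le _
  have hlt : r * B < z + 1 := Int.lt_floor_add_one _
  have hsub : (r - z / B) * B = r * B - z := by field_simp
  have hs0 : 0 ≤ r - z / B := by
    rw [sub_nonneg, div_le_iff₀ hBpos]
    exact hzle
  have hs1 : |r - z / B| < δ / 2 := by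
    rw [abs_of_nonneg hs0]
    refine lt_trans ?_ hn2
    rw [← one_div, lt_div_iff₀ hBpos, hsub]
    linarith
  refine ⟨n + 1, z, ?_, rho_lt_of_lt ?_ hs1, by linarith⟩
  · refine div_nonneg ?_ hBpos.le
    exact_mod_cast Int.floor_nonneg.2 (mul_nonneg h0 hBpos.le)
  · refine ((hφ.2.1 ?_).trans (hφ.2.2.1 _ _)).trans_lt hn1
    intro k hk
    rw [jSet, mem_ofPred_eq, abs_of_nonneg hs0] at hk
    have hlow : ∀ i < n + 1, digit a (r - z / B) i = 0 := fun i hi =>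
      digit_eq_zero_of_lt ha hs0 (by rw [← hB, hsub]; linarith) hi
    have hhigh : ∀ i, n + 1 ≤ i → digit a r i = digit a (r - z / B) i := fun i hi =>
      digit_eq_of_sub_mul_bProd_eq_int (z := z) (by rw [← hB]; field_simp; ring) hi
    rcases lt_trichotomy k n with hkn | rfl | hkn
    · exact absurd (by rw [hlow _ (by omega), hlow _ (by omega)]) hk
    · exact Or.inl rfl
    · refine Or.inr ⟨?_, by simpa using hkn⟩
      rw [jSet, mem_ofPred_eq, hhigh _ (by omega), hhigh _ (by omega)]
      exact hk

/-- For `c > 0` there are elements of `H_I` arbitrarily close to zero whose multiple by `c`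
changes digit at every place of an interval of large `ψ`-submeasure. -/
lemma exists_small_with_large_mul {a : ℕ → ℕ} (ha : ∀ n, 2 ≤ a n) {φ ψ : Set ℕ → ℝ≥0∞}
    (hφ : IsLscSubmeasure φ) (hψ : IsLscSubmeasure ψ) (htall : TallIdeal (Exh φ))
    {d : ℝ≥0∞} (hd : 0 < d)
    (hint : ∀ ε : ℝ≥0∞, 0 < ε → ∃ m n : ℕ, d ≤ ψ (Icc m n) ∧ φ (Icc m n) < ε)
    {c : ℝ} (hc : 0 < c) {δ : ℝ} (hδ : 0 < δ) :
    ∃ (N : ℕ) (z : ℤ), 0 ≤ (z : ℝ) / bProd a N ∧ rho a φ 0 (z / bProd a N) < δ ∧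
      d ≤ ψ (jSet a (c * (z / bProd a N))) := by
  obtain ⟨K₁, hK₁⟩ := pow_unbounded_of_one_lt c (one_lt_two (α := ℝ))
  obtain ⟨K₂, hK₂⟩ := pow_unbounded_of_one_lt c⁻¹ (one_lt_two (α := ℝ))
  set K := max K₁ K₂
  have hcK : c < 2 ^ K := hK₁.trans_le (pow_le_pow_right₀ one_le_two (le_max_left _ _))
  have hcK' : 1 < 2 ^ K * c := by
    have : c⁻¹ < 2 ^ K := hK₂.trans_le (pow_le_pow_right₀ one_le_two (le_max_right _ _))
    rwa [inv_lt_iff_one_lt_mul₀ hc] at this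
  have hη : 0 < ENNReal.ofReal (δ / 2) / 3 :=
    ENNReal.div_pos (ENNReal.ofReal_pos.2 (half_pos hδ)).ne' (by norm_num)
  set η := ENNReal.ofReal (δ / 2) / 3
  have hη3 : η + η + η = ENNReal.ofReal (δ / 2) := ENNReal.add_thirds _
  obtain ⟨M, hM⟩ := eventually_atTop.1 <|
    (((hφ.tendsto_Icc htall (K + 1)).eventually_lt_const hη).and
      ((hφ.tendsto_Icc htall (K + 2)).eventually_lt_const hη)).and
      ((tendsto_inv_bProd ha).eventually_lt_const (half_pos hδ))
  obtain ⟨ε, hε, hεM⟩ := hφ.exists_pos_le_singleton (M + K + 1)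
  obtain ⟨m, n, hdP, hP⟩ := hint (min ε η) (lt_min hε hη)
  have hmn : m ≤ n := by
    by_contra hcon
    rw [Icc_eq_empty hcon, hψ.1] at hdP
    exact hd.not_ge hdP
  have hmM : M + K + 1 ≤ m := by
    by_contra! hcon
    have h1 : φ {m} ≤ φ (Icc m n) := hφ.2.1 (by simpa using hmn)
    exact ((hεM m hcon).trans h1).not_gt (hP.trans_le (min_le_left _ _))
  obtain ⟨p, rfl⟩ : ∃ p, m = p + K + 1 := ⟨m - K - 1, by omega⟩
  set e : ℕ → ℤ := fun k => if k < p + K + 1 then 0 else (k % 2 : ℕ) with he_def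
  have he : ∀ k, e k = 0 ∨ e k = 1 := fun k => by
    simp only [he_def]
    split_ifs <;> omega
  set N := n + 2
  have hpos : ∀ i, 0 < bProd a i := fun i => zero_lt_one.trans_le (one_le_bProd ha i)
  set B := bProd a (N + K)
  have hB : 2 ^ K * bProd a N ≤ B := two_pow_mul_bProd_le ha N K
  have hBpos : 0 < B := hpos _
  have hNpos := hpos N
  set X : ℝ := ((digitNum a e N : ℤ) : ℝ)
  set z : ℤ := ⌈X / bProd a N / c * B⌉
  have hz1 : X / bProd a N / c * B ≤ z := Int.le_ceil _
  have hz2 : (z : ℝ) < X / bProd a N / c * B + 1 := Int.ceil_lt_add_one _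
  have hfloor : ⌊bProd a N * (c * (z / B))⌋ = digitNum a e N := by
    rw [Int.floor_eq_iff]
    have hid : bProd a N * c / B * (X / bProd a N / c * B) = X := by field_simp
    have hcoef : 0 < bProd a N * c / B := by positivity
    have hco1 : bProd a N * c / B ≤ 1 := by
      rw [div_le_one hBpos]
      nlinarith
    have hrw : bProd a N * (c * (z / B)) = bProd a N * c / B * z := by ring
    rw [hrw]
    constructor
    · have := mul_le_mul_of_nonneg_left hz1 hcoef.le
      linarith
    · have := mul_lt_mul_of_pos_left hz2 hcoef
      rw [mul_add, hid] at this
      linarith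
  have hX0 : 0 ≤ X := by
    have : ∀ i, 0 ≤ digitNum a e i := fun i => by
      induction i with
      | zero => exact le_rfl
      | succ i ih =>
        have := he i
        rw [digitNum]
        have : 0 ≤ e i := by omega
        positivity
    exact Int.cast_nonneg (this N)
  have hq0 : 0 ≤ (z : ℝ) / B := by
    refine div_nonneg (le_trans ?_ hz1) hBpos.le
    positivity
  set q : ℝ := z / B
  have hqp : q * bProd a (p + 1) < 1 := by
    have h1 : ⌊bProd a (p + K + 1) * (c * q)⌋ = digitNum a e (p + K + 1) :=
      floor_bProd_mul_eq_digitNum ha he hfloor (by omega)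
    have h2 : ∀ i ≤ p + K + 1, digitNum a e i = 0 := by
      intro i hi
      induction i with
      | zero => rfl
      | succ i ih =>
        rw [digitNum, ih (by omega)]
        simp only [he_def]
        rw [if_pos (by omega)]
        simp
    rw [h2 _ le_rfl, Int.floor_eq_zero_iff] at h1
    have h3 := h1.2
    have h4 := two_pow_mul_bProd_le ha (p + 1) K
    rw [show p + 1 + K = p + K + 1 by ring] at h4
    have h5 := mul_le_mul_of_nonneg_right h4 (mul_nonneg hc.le hq0)
    have h6 : 0 ≤ q * bProd a (p + 1) := mul_nonneg hq0 (hpos _).le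
    nlinarith
  refine ⟨N + K, z, hq0, rho_lt_of_lt ?_ ?_, hdP.trans (hψ.2.1 fun k hk => ?_)⟩
  · rw [zero_sub, abs_neg, abs_of_nonneg hq0, ← hη3]
    have hsub : jSet a q ⊆ Icc p (p + (K + 1)) ∪ Icc (p + K + 1) n ∪ Icc n (n + (K + 2)) := by
      intro k hk
      rw [jSet, mem_ofPred_eq] at hk
      have h1 : p ≤ k := by
        by_contra! hcon
        refine hk ?_
        rw [digit_eq_zero_of_lt ha hq0 hqp (by omega), digit_eq_zero_of_lt ha hq0 hqp (by omega)]
      have h2 : k < N + K := by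
        by_contra! hcon
        have hqB : q * bProd a (N + K) = z := div_mul_cancel₀ _ hBpos.ne'
        refine hk ?_
        rw [digit_eq_zero_of_mul_bProd_eq_int hqB hcon,
          digit_eq_zero_of_mul_bProd_eq_int hqB (by omega)]
      simp only [mem_union, mem_Icc]
      omega
    refine (hφ.2.1 hsub).trans_lt <| (hφ.2.2.1 _ _).trans_lt <|
      ENNReal.add_lt_add ((hφ.2.2.1 _ _).trans_lt <| ENNReal.add_lt_add ?_ ?_) ?_
    · exact (hM p (by omega)).1.1
    · exact hP.trans_le (min_le_right _ _)
    · exact (hM n (by omega)).1.2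
  · rw [zero_sub, abs_neg, abs_of_nonneg hq0]
    refine lt_trans ?_ (hM (p + 1) (by omega)).2
    rwa [← one_div, lt_div_iff₀ (hpos _)]
  · obtain ⟨hk1, hk2⟩ := hk
    rw [jSet, mem_ofPred_eq, digit_eq_of_floor_eq_digitNum ha he hfloor (by omega),
      digit_eq_of_floor_eq_digitNum ha he hfloor (by omega)]
    simp only [he_def]
    rw [if_neg (by omega), if_neg (by omega)]
    omega

/-- Lemma 3.3: every ρ-continuous `ℚ_a`-module homomorphism
`H_I → H_J` is zero. -/
theorem hom_eq_zero (a : ℕ → ℕ) (ha : ∀ n, 2 ≤ a n) (hu : UniformBase a)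
    (φ ψ : Set ℕ → ℝ≥0∞) (hφ : IsLscSubmeasure φ) (hψ : IsLscSubmeasure ψ)
    (hidI : IsIdeal (Exh φ)) (hidJ : IsIdeal (Exh ψ))
    (htrI : TransInv (Exh φ)) (htrJ : TransInv (Exh ψ))
    (htall : TallIdeal (Exh φ))
    (hadI : AdaptedTo a (Exh φ)) (hadJ : AdaptedTo a (Exh ψ))
    (d : ℝ≥0∞) (hd : 0 < d)
    (hint : ∀ ε : ℝ≥0∞, 0 < ε →
      ∃ m n : ℕ, d ≤ ψ (Set.Icc m n) ∧ φ (Set.Icc m n) < ε)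
    (f : ℝ → ℝ)
    (hmaps : Set.MapsTo f (Hset a (Exh φ)) (Hset a (Exh ψ)))
    (hadd : ∀ r ∈ Hset a (Exh φ), ∀ s ∈ Hset a (Exh φ), f (r + s) = f r + f s)
    (hsmul : ∀ q ∈ Qa a, ∀ r ∈ Hset a (Exh φ), f (q * r) = q * f r)
    (hcont : ∀ r ∈ Hset a (Exh φ), ∀ ε : ℝ, 0 < ε → ∃ δ : ℝ, 0 < δ ∧
      ∀ s ∈ Hset a (Exh φ), rho a φ r s < δ → rho a ψ (f r) (f s) < ε) :
    ∀ r ∈ Hset a (Exh φ), f r = 0 := by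
  have h1mem : (1 : ℝ) ∈ Hset a (Exh φ) :=
    mem_Hset_of_mul_bProd_eq_int hφ zero_le_one (n := 0) (z := 1) (by simp [bProd])
  have h0mem : (0 : ℝ) ∈ Hset a (Exh φ) :=
    mem_Hset_of_mul_bProd_eq_int hφ le_rfl (n := 0) (z := 0) (by simp)
  have hbpos : ∀ n, 0 < bProd a n := fun n => zero_lt_one.trans_le (one_le_bProd ha n)
  have hmem : ∀ (n : ℕ) (z : ℤ), 0 ≤ (z : ℝ) / bProd a n →
      (z : ℝ) / bProd a n ∈ Hset a (Exh φ) := fun n z h =>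
    mem_Hset_of_mul_bProd_eq_int hφ h (div_mul_cancel₀ _ (hbpos n).ne')
  have hrat : ∀ (n : ℕ) (z : ℤ), f (z / bProd a n) = z / bProd a n * f 1 := fun n z => by
    simpa using hsmul _ (int_div_bProd_mem_Qa ha hu z n) 1 h1mem
  have hlin : ∀ r ∈ Hset a (Exh φ), 0 ≤ r → f r = r * f 1 := by
    intro r hr h0
    refine eq_of_forall_dist_le fun ε hε => ?_
    obtain ⟨δ, hδ, hcr⟩ := hcont r hr (ε / 2) (half_pos hε)
    have hε' : 0 < ε / 2 / (|f 1| + 1) := by positivity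
    obtain ⟨n, z, hz, hρ, habs⟩ := exists_truncation ha hφ htall h0 hr (lt_min hδ hε')
    have h1 := hcr _ (hmem n z hz) (hρ.trans_le (min_le_left _ _))
    rw [hrat, rho] at h1
    have h2 := habs.trans_le (min_le_right _ _)
    rw [lt_div_iff₀ (by positivity)] at h2
    have h3 : |f r - z / bProd a n * f 1| < ε / 2 :=
      (le_add_of_nonneg_left ENNReal.toReal_nonneg).trans_lt h1
    have h4 : |z / bProd a n * f 1 - r * f 1| ≤ ε / 2 := by
      rw [← sub_mul, abs_mul, abs_sub_comm]
      nlinarith [abs_nonneg (r - z / bProd a n)]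
    rw [Real.dist_eq]
    linarith [abs_sub_le (f r) (z / bProd a n * f 1) (r * f 1)]
  have hf1 : f 1 = 0 := by
    by_contra hne
    have hmin0 : 0 < min d 1 := lt_min hd one_pos
    have hmintop : min d 1 ≠ ⊤ := ((min_le_right _ _).trans_lt ENNReal.one_lt_top).ne
    obtain ⟨δ, hδ, hc0⟩ := hcont 0 h0mem _ (ENNReal.toReal_pos hmin0.ne' hmintop)
    obtain ⟨n, z, hz, hρ, hlarge⟩ := exists_small_with_large_mul ha hφ hψ htall hd hint
      (abs_pos.2 hne) hδ
    have h1 := hc0 _ (hmem n z hz) hρ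
    have hf0 : f 0 = 0 := by rw [hlin 0 h0mem le_rfl, zero_mul]
    have habs : |f (z / bProd a n)| = |f 1| * (z / bProd a n) := by
      rw [hrat, abs_mul, abs_of_nonneg hz, mul_comm]
    have htop : ψ (jSet a |f (z / bProd a n)|) < ⊤ :=
      hψ.lt_top_of_mem_Exh (hmaps (hmem n z hz))
    rw [rho, hf0, zero_sub, abs_neg] at h1
    rw [← habs] at hlarge
    have h2 := ENNReal.toReal_mono htop.ne ((min_le_left d 1).trans hlarge)
    linarith [abs_nonneg (f (z / bProd a n))]
  intro r hr
  rcases le_total 0 r with h0 | h0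
  · rw [hlin r hr h0, hf1, mul_zero]
  · have hneg : -r ∈ Hset a (Exh φ) := by
      rw [Hset, mem_ofPred_eq, abs_neg]
      exact hr
    have h1 := hsmul _ (int_mem_Qa a (-1)) r hr
    have h2 := hlin (-r) hneg (neg_nonneg.2 h0)
    rw [hf1, mul_zero] at h2
    push_cast at h1
    rw [neg_one_mul, h2] at h1
    linarith
end

section
/- Every subring R of ℚ (containing 1) is of the form ℚ_a for some base sequence a; that is, there exists a sequence a = (a_n)_{n≥1} of integers with a_n ≥ 2 for all n such that R = ℚ_a. -/
open Set Filter
open scoped ENNReal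

/-- For every set `S` of primes there is a base sequence `a` with `pr(a) = S`. -/
theorem exists_prSet_eq (S : Set ℕ) (hS : ∀ p ∈ S, p.Prime) :
    ∃ a : ℕ → ℕ, (∀ n, 2 ≤ a n) ∧ prSet a = S := by
  classical
  choose q hq hqp using fun n : ℕ => Nat.exists_infinite_primes (n + 2)
  refine ⟨fun n => (∏ p ∈ Finset.range n with p ∈ S, p) * q n, fun n => ?_, ?_⟩
  · have h : 0 < ∏ p ∈ Finset.range n with p ∈ S, p :=
      Finset.prod_pos fun p hp => (hS p (Finset.mem_filter.1 hp).2).pos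
    have := (hqp n).two_le
    nlinarith
  · ext p
    constructor
    · rintro ⟨hp, hdvd⟩
      obtain ⟨n, hn, hpn⟩ := (hdvd.and (eventually_ge_atTop p)).exists
      rcases hp.dvd_mul.1 hn with h | h
      · obtain ⟨r, hr, hpr⟩ := (hp.prime.dvd_finsetProd_iff _).1 h
        have hrS := (Finset.mem_filter.1 hr).2
        rwa [(Nat.prime_dvd_prime_iff_eq hp (hS r hrS)).1 hpr]
      · have := (Nat.prime_dvd_prime_iff_eq hp (hqp n)).1 h
        have := hq n
        omega
    · intro hp
      refine ⟨hS p hp, ?_⟩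
      filter_upwards [eventually_gt_atTop p] with n hn
      exact dvd_mul_of_dvd_left
        (Finset.dvd_prod_of_mem _ (Finset.mem_filter.2 ⟨Finset.mem_range.2 hn, hp⟩)) _

/-- A subring of `ℚ` containing `r` contains the inverse of the reduced denominator of `r`. -/
theorem Subring.inv_den_mem (R : Subring ℚ) {r : ℚ} (hr : r ∈ R) : (r.den : ℚ)⁻¹ ∈ R := by
  obtain ⟨u, v, huv⟩ : IsCoprime r.num (r.den : ℤ) :=
    Int.isCoprime_iff_gcd_eq_one.2 (by simpa [Int.gcd] using r.reduced)
  have huv' : (u : ℚ) * r.num + v * r.den = 1 := by exact_mod_cast huv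
  have hrd : r * r.den = r.num := Rat.mul_den_eq_num r
  have h : (r.den : ℚ)⁻¹ = u * r + v := by
    refine (eq_inv_of_mul_eq_one_left ?_).symm
    linear_combination huv' + (u : ℚ) * hrd
  rw [h]
  exact R.add_mem (R.mul_mem (intCast_mem R u) hr) (intCast_mem R v)

/-- A subring of `ℚ` containing `1 / l` contains `1 / d` for every divisor `d` of `l`. -/
theorem Subring.inv_mem_of_dvd (R : Subring ℚ) {d l : ℕ} (hl : l ≠ 0) (hdl : d ∣ l)
    (h : (l : ℚ)⁻¹ ∈ R) : (d : ℚ)⁻¹ ∈ R := by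
  obtain ⟨c, rfl⟩ := hdl
  have hd : (d : ℚ) ≠ 0 := by exact_mod_cast left_ne_zero_of_mul hl
  have hc : (c : ℚ) ≠ 0 := by exact_mod_cast right_ne_zero_of_mul hl
  have h' : (d : ℚ)⁻¹ = c * ((d * c : ℕ) : ℚ)⁻¹ := by
    push_cast
    field_simp
  rw [h']
  exact R.mul_mem (natCast_mem R c) h

/-- A subring of `ℚ` containing `1 / p` for all prime divisors `p` of `l` contains `1 / l`. -/
theorem Subring.inv_mem_of_prime_inv_mem (R : Subring ℚ) (l : ℕ)
    (h : ∀ p : ℕ, p.Prime → p ∣ l → (p : ℚ)⁻¹ ∈ R) : (l : ℚ)⁻¹ ∈ R := by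
  induction l using Nat.recOnMul with
  | zero => simp [R.zero_mem]
  | one => simp [R.one_mem]
  | prime p hp => exact h p hp dvd_rfl
  | mul m n hm hn =>
    rw [Nat.cast_mul, mul_inv]
    exact R.mul_mem (hm fun p hp hd => h p hp (hd.mul_right n))
      (hn fun p hp hd => h p hp (hd.mul_left m))

/-- every subring of ℚ is `ℚ_a` for some base sequence `a`. -/
theorem subring_rat_eq_Qa (R : Subring ℚ) :
    ∃ a : ℕ → ℕ, (∀ n, 2 ≤ a n) ∧
      (R : Set ℚ) = {q : ℚ | ∃ (k : ℤ) (l : ℕ), 0 < l ∧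
        (∀ p : ℕ, p.Prime → p ∣ l → p ∈ prSet a) ∧
        q = (k : ℚ) / (l : ℚ)} := by
  obtain ⟨a, ha, hpr⟩ := exists_prSet_eq {p | p.Prime ∧ (p : ℚ)⁻¹ ∈ R} fun p hp => hp.1
  refine ⟨a, ha, ?_⟩
  rw [hpr]
  ext r
  constructor
  · intro hr
    exact ⟨r.num, r.den, r.pos, fun p hp hd =>
      ⟨hp, R.inv_mem_of_dvd r.den_nz hd (R.inv_den_mem hr)⟩, (Rat.num_div_den r).symm⟩
  · rintro ⟨k, l, -, hl, rfl⟩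
    rw [div_eq_mul_inv]
    exact R.mul_mem (intCast_mem R k)
      (R.inv_mem_of_prime_inv_mem l fun p hp hd => (hl p hp hd).2)
end

section
/- Let φ and ψ be lsc submeasures with Exh(φ) = Exh(ψ). Then for each ε > 0 there exists δ > 0 such that for every x ⊆ ℕ, if φ(x) < δ then ψ(x) < ε. -/
open Set Filter
open scoped ENNReal

namespace IsLscSubmeasure

variable {φ : Set ℕ → ℝ≥0∞}

lemma mono (hφ : IsLscSubmeasure φ) {x y : Set ℕ} (hxy : x ⊆ y) : φ x ≤ φ y :=
  hφ.2.1 hxy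

lemma biUnion_finset_le (hφ : IsLscSubmeasure φ) (F : ℕ → Set ℕ) (s : Finset ℕ) :
    φ (⋃ n ∈ s, F n) ≤ ∑ n ∈ s, φ (F n) := by
  induction s using Finset.induction_on with
  | empty => simp [hφ.1]
  | insert a s ha ih =>
    rw [Finset.set_biUnion_insert, Finset.sum_insert ha]
    exact (hφ.2.2.1 _ _).trans (by gcongr)

/-- A submeasure is bounded by `c` on `x` if it is bounded by `c` on every initial part of `x`. -/
lemma le_of_forall_inter_le (hφ : IsLscSubmeasure φ) {x : Set ℕ} {c : ℝ≥0∞}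
    (h : ∀ n : ℕ, φ (x ∩ {k | k < n}) ≤ c) : φ x ≤ c := by
  rw [hφ.2.2.2.2 x]
  exact iSup_le h

/-- Countable subadditivity along a sequence of sets that moves off to infinity. -/
lemma iUnion_le_tsum (hφ : IsLscSubmeasure φ) {F : ℕ → Set ℕ}
    (hF : ∀ n, ∀ k ∈ F n, n ≤ k) : φ (⋃ n, F n) ≤ ∑' n, φ (F n) := by
  refine hφ.le_of_forall_inter_le fun m => ?_
  calc φ ((⋃ n, F n) ∩ {k | k < m}) ≤ φ (⋃ n ∈ Finset.range m, F n) := by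
        refine hφ.mono ?_
        rintro k ⟨hk, hkm⟩
        obtain ⟨n, hn⟩ := mem_iUnion.1 hk
        exact mem_biUnion (Finset.mem_coe.2 (Finset.mem_range.2 ((hF n k hn).trans_lt hkm))) hn
    _ ≤ ∑ n ∈ Finset.range m, φ (F n) := hφ.biUnion_finset_le F _
    _ ≤ ∑' n, φ (F n) := ENNReal.sum_le_tsum _

/-- Finite sets moving off to infinity with summable submeasures have union in `Exh φ`. -/
lemma iUnion_mem_Exh (hφ : IsLscSubmeasure φ) {F : ℕ → Set ℕ}
    (hF : ∀ n, ∀ k ∈ F n, n ≤ k) (hfin : ∀ n, (F n).Finite) (hsum : ∑' n, φ (F n) ≠ ⊤) :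
    (⋃ n, F n) ∈ Exh φ := by
  refine ENNReal.tendsto_nhds_zero.2 fun ε hε => ?_
  have htail := ENNReal.tendsto_nhds_zero.1
    (ENNReal.tendsto_sum_nat_add (fun n => φ (F n)) hsum) ε hε
  obtain ⟨N, hN⟩ := htail.exists
  obtain ⟨M, hM⟩ := ((Finset.range N).finite_toSet.biUnion fun n _ => hfin n).bddAbove
  filter_upwards [eventually_gt_atTop M] with m hm
  refine (hφ.mono (y := ⋃ n, F (n + N)) ?_).trans ((hφ.iUnion_le_tsum fun n k hk =>
    (Nat.le_add_right n N).trans (hF _ k hk)).trans hN)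
  rintro k ⟨hk, hkm⟩
  obtain ⟨n, hn⟩ := mem_iUnion.1 hk
  rcases lt_or_ge n N with h | h
  · have : k ≤ M := hM (mem_biUnion (Finset.mem_coe.2 (Finset.mem_range.2 h)) hn)
    exact absurd (this.trans_lt hm) hkm
  · exact mem_iUnion.2 ⟨n - N, by rwa [Nat.sub_add_cancel h]⟩

end IsLscSubmeasure

/-- Lemma 2.7(i). -/
theorem submeasure_compare (φ ψ : Set ℕ → ℝ≥0∞)
    (hφ : IsLscSubmeasure φ) (hψ : IsLscSubmeasure ψ)
    (h : Exh φ = Exh ψ) :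
    ∀ ε : ℝ≥0∞, 0 < ε → ∃ δ : ℝ≥0∞, 0 < δ ∧ ∀ x : Set ℕ, φ x < δ → ψ x < ε := by
  intro ε hε
  by_contra! hcon
  obtain ⟨c, hc, hcε⟩ := exists_between hε
  have hF : ∀ n : ℕ, ∃ F : Set ℕ, F.Finite ∧ (∀ k ∈ F, n ≤ k) ∧ φ F ≤ 2⁻¹ ^ n ∧ c < ψ F := by
    intro n
    obtain ⟨x, hx, hxε⟩ := hcon (min (2⁻¹ ^ n) ((Finset.range n).inf fun k => φ {k}))
      (lt_min (ENNReal.pow_pos (by simp) n)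
        ((Finset.lt_inf_iff ENNReal.zero_lt_top).2 fun k _ => (hφ.2.2.2.1 k).1))
    obtain ⟨hx₁, hx₂⟩ := lt_min_iff.1 hx
    have hcx := hcε.trans_le hxε
    rw [hψ.2.2.2.2 x] at hcx
    obtain ⟨m, hm⟩ := lt_iSup_iff.1 hcx
    refine ⟨x ∩ {k | k < m}, (finite_lt_nat m).inter_of_right x, ?_,
      (hφ.mono inter_subset_left).trans hx₁.le, hm⟩
    rintro k ⟨hk, -⟩
    by_contra! hkn
    exact absurd ((hφ.mono (singleton_subset_iff.2 hk)).trans_lt hx₂)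
      (Finset.inf_le (f := fun k => φ {k}) (Finset.mem_range.2 hkn)).not_gt
  choose F hfin hge hsmall hlarge using hF
  have hmem : (⋃ n, F n) ∈ Exh φ := by
    refine hφ.iUnion_mem_Exh hge hfin (ne_top_of_le_ne_top ?_ (ENNReal.tsum_le_tsum hsmall))
    simp [ENNReal.tsum_geometric]
  rw [h] at hmem
  obtain ⟨m, hm⟩ := (ENNReal.tendsto_nhds_zero.1 hmem c hc).exists
  refine (hlarge m).not_ge ((hψ.mono ?_).trans hm)
  exact fun k hk => ⟨mem_iUnion.2 ⟨m, hk⟩, (hge m k hk).not_gt⟩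
end

section
/- Let X be a set and ρ : X × X → ℝ a function such that: (i) ρ(x,y) ≥ 0 for all x, y, and ρ(x,y) = 0 if and only if x = y; (ii) ρ(x,y) = ρ(y,x) for all x, y; (iii) for each ε > 0 there exists δ > 0 such that for all x, y, z ∈ X, if ρ(x,y) < δ and ρ(y,z) < δ then ρ(x,z) < ε. Then there exists a metric d on X such that for each ε > 0 there exists δ > 0 with: (ρ(x,y) < δ ⇒ d(x,y) < ε) and (d(x,y) < δ ⇒ ρ(x,y) < ε), for all x, y ∈ X. -/
open Set Filter
open scoped ENNReal

/-- The uniform structure with entourages `{(x, y) | ρ x y < ε}`, for a symmetric `ρ` vanishing on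
the diagonal and satisfying a uniform weak form of the triangle inequality. -/
@[reducible] def UniformSpace.ofWeakTriangle {X : Type*} (ρ : X → X → ℝ)
    (nonneg : ∀ x y, 0 ≤ ρ x y) (refl : ∀ x, ρ x x = 0) (symm : ∀ x y, ρ x y = ρ y x)
    (weak_triangle : ∀ ε : ℝ, 0 < ε → ∃ δ : ℝ, 0 < δ ∧
      ∀ x y z, ρ x y < δ → ρ y z < δ → ρ x z < ε) : UniformSpace X :=
  .ofCore
    { uniformity := Filter.comap (fun p : X × X => ρ p.1 p.2) (nhds 0)
      refl := by
        rw [(Metric.nhds_basis_ball.comap _).ge_iff]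
        rintro ε hε ⟨x, y⟩ hxy
        obtain rfl : x = y := by simpa using hxy
        simpa [refl x] using hε
      symm := by
        rw [tendsto_comap_iff]
        exact tendsto_comap.congr fun p => symm p.1 p.2
      comp := by
        rw [(Metric.nhds_basis_ball.comap _).ge_iff]
        intro ε hε
        obtain ⟨δ, hδ, h⟩ := weak_triangle ε hε
        refine mem_of_superset (mem_lift' (preimage_mem_comap (Metric.ball_mem_nhds 0 hδ))) ?_
        rintro ⟨x, z⟩ ⟨y, hxy, hyz⟩
        simp only [mem_preimage, mem_ball_zero_iff, Real.norm_eq_abs,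
          abs_of_nonneg (nonneg _ _)] at hxy hyz ⊢
        exact h x y z hxy hyz }

theorem UniformSpace.ofWeakTriangle_hasBasis {X : Type*} {ρ : X → X → ℝ}
    (nonneg : ∀ x y, 0 ≤ ρ x y) (refl : ∀ x, ρ x x = 0) (symm : ∀ x y, ρ x y = ρ y x)
    (weak_triangle : ∀ ε : ℝ, 0 < ε → ∃ δ : ℝ, 0 < δ ∧
      ∀ x y z, ρ x y < δ → ρ y z < δ → ρ x z < ε) :
    (@uniformity X (ofWeakTriangle ρ nonneg refl symm weak_triangle)).HasBasis
      (fun ε : ℝ => 0 < ε) (fun ε => {p | ρ p.1 p.2 < ε}) := by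
  refine (Metric.nhds_basis_ball.comap fun p : X × X => ρ p.1 p.2).congr (fun _ => Iff.rfl) ?_
  intro ε _
  ext p
  simp [abs_of_nonneg (nonneg _ _)]

/-- Chittenden-type metrization lemma. -/
theorem metrization_of_weak_triangle {X : Type*} (ρ : X → X → ℝ)
    (h1 : ∀ x y, 0 ≤ ρ x y) (h2 : ∀ x y, ρ x y = 0 ↔ x = y)
    (h3 : ∀ x y, ρ x y = ρ y x)
    (h4 : ∀ ε : ℝ, 0 < ε → ∃ δ : ℝ, 0 < δ ∧
      ∀ x y z, ρ x y < δ → ρ y z < δ → ρ x z < ε) :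
    ∃ d : X → X → ℝ,
      (∀ x y, 0 ≤ d x y) ∧ (∀ x y, d x y = 0 ↔ x = y) ∧
      (∀ x y, d x y = d y x) ∧ (∀ x y z, d x z ≤ d x y + d y z) ∧
      ∀ ε : ℝ, 0 < ε → ∃ δ : ℝ, 0 < δ ∧
        ∀ x y, (ρ x y < δ → d x y < ε) ∧ (d x y < δ → ρ x y < ε) := by
  have refl x : ρ x x = 0 := (h2 x x).2 rfl
  let U := UniformSpace.ofWeakTriangle ρ h1 refl h3 h4
  have hB : (uniformity X).HasBasis (fun ε : ℝ => 0 < ε) (fun ε => {p | ρ p.1 p.2 < ε}) :=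
    UniformSpace.ofWeakTriangle_hasBasis h1 refl h3 h4
  have : (uniformity X).IsCountablyGenerated :=
    inferInstanceAs (Filter.comap (fun p : X × X => ρ p.1 p.2) (nhds 0)).IsCountablyGenerated
  let := UniformSpace.pseudoMetricSpace X
  have hD : (uniformity X).HasBasis (fun ε : ℝ => 0 < ε) (fun ε => {p | dist p.1 p.2 < ε}) :=
    Metric.uniformity_basis_dist
  have ρ_lt : ∀ ε : ℝ, 0 < ε → ∃ δ : ℝ, 0 < δ ∧ ∀ x y, dist x y < δ → ρ x y < ε := by
    intro ε hε
    obtain ⟨δ, hδ, h⟩ := hD.mem_iff.1 (hB.mem_of_mem hε)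
    exact ⟨δ, hδ, fun x y hxy => @h (x, y) hxy⟩
  refine ⟨dist, fun _ _ => dist_nonneg, fun x y => ⟨fun hxy => ?_, ?_⟩, dist_comm,
    dist_triangle, fun ε hε => ?_⟩
  · refine (h2 x y).1 (le_antisymm (le_of_forall_pos_le_add fun ε hε => ?_) (h1 x y))
    obtain ⟨δ, hδ, h⟩ := ρ_lt ε hε
    simpa using (h x y (hxy.trans_lt hδ)).le
  · rintro rfl
    exact dist_self x
  · obtain ⟨δ₁, hδ₁, h₁⟩ := hB.mem_iff.1 (hD.mem_of_mem hε)
    obtain ⟨δ₂, hδ₂, h₂⟩ := ρ_lt ε hε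
    exact ⟨min δ₁ δ₂, lt_min hδ₁ hδ₂, fun x y =>
      ⟨fun hxy => @h₁ (x, y) (hxy.trans_le (min_le_left _ _)),
        fun hxy => h₂ x y (hxy.trans_le (min_le_right _ _))⟩⟩
end
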